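/- In the optimal solution of the weighted sum rate problem for the broadcast channel, the sum rate is monotonically increasing: let 0 < μ₁ < μ₂ and suppose all harvested energies E_i, Ē_{1i}, Ē_{2i} are strictly positive. If (r₁, r₂) is a feasible rate policy maximizing μ₁·∑_{i=1}^N r_{1i} + μ₂·∑_{i=1}^N r_{2i} over all feasible policies, then the sequence i ↦ r_{1i} + r_{2i} is nondecreasing in i. -/

import Mathlib

open Finset

/-- Minimum transmit power needed to deliver rates `r1` (strong user) and `r2`
(weak user) on the degraded Gaussian BC with noise variances `1` and `σ2 > 1`. -/
noncomputable def Fmin (σ2 r1 r2 : ℝ) : ℝ :=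
  (σ2 - 1) * (2 : ℝ) ^ (2 * r2) + (2 : ℝ) ^ (2 * (r1 + r2)) - σ2

/-- Feasibility of a rate policy `(r1, r2)` for the two-user degraded BC with
transmitter energies `E`, strong-receiver energies `Eb1` and weak-receiver
energies `Eb2` (decoding cost `φ(r) = 2^{2r} − 1`). -/
def BCFeasible (N : ℕ) (σ2 : ℝ) (E Eb1 Eb2 : ℕ → ℝ) (r1 r2 : ℕ → ℝ) : Prop :=
  (∀ i ∈ Finset.Icc 1 N, 0 ≤ r1 i) ∧
  (∀ i ∈ Finset.Icc 1 N, 0 ≤ r2 i) ∧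
  (∀ k ∈ Finset.Icc 1 N,
      ∑ i ∈ Finset.Icc 1 k, Fmin σ2 (r1 i) (r2 i) ≤ ∑ i ∈ Finset.Icc 1 k, E i) ∧
  (∀ k ∈ Finset.Icc 1 N,
      ∑ i ∈ Finset.Icc 1 k, ((2 : ℝ) ^ (2 * (r1 i + r2 i)) - 1) ≤
        ∑ i ∈ Finset.Icc 1 k, Eb1 i) ∧
  (∀ k ∈ Finset.Icc 1 N,
      ∑ i ∈ Finset.Icc 1 k, ((2 : ℝ) ^ (2 * r2 i) - 1) ≤
        ∑ i ∈ Finset.Icc 1 k, Eb2 i)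

lemma bc_upd_sum (f g : ℕ → ℝ) (i j k : ℕ) (hij : i < j)
    (h : ∀ l, l ≠ i → l ≠ j → g l = f l) :
    ∑ l ∈ Finset.Icc 1 k, g l = ∑ l ∈ Finset.Icc 1 k, f l
      + (if i ∈ Finset.Icc 1 k then g i - f i else 0)
      + (if j ∈ Finset.Icc 1 k then g j - f j else 0) := by
  have e : ∀ l, g l = f l + (if i = l then g i - f i else 0)
      + (if j = l then g j - f j else 0) := by
    intro l
    by_cases h1 : i = l
    · subst h1
      rw [if_pos rfl, if_neg (by omega)]; ring
    · by_cases h2 : j = l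
      · subst h2
        rw [if_neg h1, if_pos rfl]; ring
      · rw [if_neg h1, if_neg h2, h l (Ne.symm h1) (Ne.symm h2)]; ring
  rw [Finset.sum_congr rfl (fun l _ => e l), Finset.sum_add_distrib, Finset.sum_add_distrib,
    Finset.sum_ite_eq, Finset.sum_ite_eq]

lemma bc_upd_le (f g : ℕ → ℝ) (i j k : ℕ) (hi : 1 ≤ i) (hij : i < j)
    (h : ∀ l, l ≠ i → l ≠ j → g l = f l) (h1 : g i ≤ f i) (h2 : g i + g j ≤ f i + f j) :
    ∑ l ∈ Finset.Icc 1 k, g l ≤ ∑ l ∈ Finset.Icc 1 k, f l := by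
  rw [bc_upd_sum f g i j k hij h]
  simp only [Finset.mem_Icc]
  split_ifs <;> first | linarith | omega

lemma bc_mean (a b : ℝ) : ∃ m : ℝ, 2 * (2 : ℝ) ^ (2 * m) = 2 ^ (2 * a) + 2 ^ (2 * b) ∧
    a + b ≤ 2 * m ∧ (a ≠ b → a + b < 2 * m) := by
  have ha : (0 : ℝ) < 2 ^ (2 * a) := by positivity
  have hb : (0 : ℝ) < 2 ^ (2 * b) := by positivity
  have hm : (2 : ℝ) ^ (2 * (Real.logb 2 (((2 : ℝ) ^ (2 * a) + 2 ^ (2 * b)) / 2) / 2))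
      = ((2 : ℝ) ^ (2 * a) + 2 ^ (2 * b)) / 2 := by
    rw [mul_div_cancel₀ _ (by norm_num : (2 : ℝ) ≠ 0)]
    exact Real.rpow_logb (by norm_num) (by norm_num) (by positivity)
  generalize Real.logb 2 (((2 : ℝ) ^ (2 * a) + 2 ^ (2 * b)) / 2) / 2 = m at hm
  have e1 : (2 : ℝ) ^ (2 * (a + b)) = 2 ^ (2 * a) * 2 ^ (2 * b) := by
    rw [← Real.rpow_add (by norm_num)]; ring_nf
  have e2 : (2 : ℝ) ^ (2 * (2 * m)) = 2 ^ (2 * m) * 2 ^ (2 * m) := by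
    rw [← Real.rpow_add (by norm_num)]; ring_nf
  refine ⟨m, by rw [hm]; ring, ?_, ?_⟩
  · have : (2 : ℝ) ^ (2 * (a + b)) ≤ 2 ^ (2 * (2 * m)) := by
      rw [e1, e2, hm]
      nlinarith [sq_nonneg ((2 : ℝ) ^ (2 * a) - 2 ^ (2 * b))]
    have := (Real.rpow_le_rpow_left_iff (by norm_num : (1 : ℝ) < 2)).1 this
    linarith
  · intro hab
    have hne : (2 : ℝ) ^ (2 * a) - 2 ^ (2 * b) ≠ 0 := by
      intro h0
      have h3 : (2 : ℝ) ^ (2 * a) = 2 ^ (2 * b) := by linarith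
      have h4 := (Real.rpow_le_rpow_left_iff (by norm_num : (1 : ℝ) < 2)).1 h3.le
      have h5 := (Real.rpow_le_rpow_left_iff (by norm_num : (1 : ℝ) < 2)).1 h3.ge
      exact hab (by linarith)
    have : (2 : ℝ) ^ (2 * (a + b)) < 2 ^ (2 * (2 * m)) := by
      rw [e1, e2, hm]
      have := sq_pos_of_ne_zero hne
      nlinarith
    have := (Real.rpow_lt_rpow_left_iff (by norm_num : (1 : ℝ) < 2)).1 this
    linarith

lemma bc_mono {x y : ℝ} : (2 : ℝ) ^ (2 * x) ≤ 2 ^ (2 * y) ↔ x ≤ y := by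
  rw [Real.rpow_le_rpow_left_iff (by norm_num : (1 : ℝ) < 2)]
  constructor <;> intro h <;> linarith

/-- in the optimal solution of the BC weighted sum rate problem with
`0 < μ1 < μ2` and strictly positive energies, the sum rate is nondecreasing in time. -/
theorem bc_optimal_sum_rate_monotone
    (N : ℕ) (hN : 1 ≤ N)
    (σ2 : ℝ) (hσ2 : 1 < σ2)
    (E Eb1 Eb2 : ℕ → ℝ)
    (hE : ∀ i ∈ Finset.Icc 1 N, 0 < E i)
    (hEb1 : ∀ i ∈ Finset.Icc 1 N, 0 < Eb1 i)
    (hEb2 : ∀ i ∈ Finset.Icc 1 N, 0 < Eb2 i)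
    (μ1 μ2 : ℝ) (hμ1 : 0 < μ1) (hμ12 : μ1 < μ2)
    (r1 r2 : ℕ → ℝ)
    (hfeas : BCFeasible N σ2 E Eb1 Eb2 r1 r2)
    (hopt : ∀ r1' r2' : ℕ → ℝ, BCFeasible N σ2 E Eb1 Eb2 r1' r2' →
        μ1 * ∑ i ∈ Finset.Icc 1 N, r1' i + μ2 * ∑ i ∈ Finset.Icc 1 N, r2' i ≤
        μ1 * ∑ i ∈ Finset.Icc 1 N, r1 i + μ2 * ∑ i ∈ Finset.Icc 1 N, r2 i) :
    ∀ i j : ℕ, 1 ≤ i → i ≤ j → j ≤ N → r1 i + r2 i ≤ r1 j + r2 j := by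
  intro i j hi hij hjN
  by_contra hcon
  push Not at hcon
  have hlt : i < j := by
    rcases hij.lt_or_eq with h | h
    · exact h
    · subst h; exact absurd hcon (lt_irrefl _)
  obtain ⟨f1, f2, f3, f4, f5⟩ := hfeas
  have hiM : i ∈ Finset.Icc 1 N := Finset.mem_Icc.2 ⟨hi, by omega⟩
  have hjM : j ∈ Finset.Icc 1 N := Finset.mem_Icc.2 ⟨by omega, hjN⟩
  have a1 := f1 i hiM
  have a2 := f2 i hiM
  have b1 := f1 j hjM
  have b2 := f2 j hjM
  obtain ⟨m, hm, -, hm2⟩ := bc_mean (r1 i + r2 i) (r1 j + r2 j)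
  have hm2 := hm2 hcon.ne'
  have hS := bc_mono.2 hcon.le
  have hmj : r1 j + r2 j ≤ m := bc_mono.1 (by linarith)
  have hmi : m ≤ r1 i + r2 i := bc_mono.1 (by linarith)
  obtain ⟨p, q, hp0, hq0, hpm, hqm, hpq, hpi, hsum⟩ : ∃ p q : ℝ, 0 ≤ p ∧ 0 ≤ q ∧ p ≤ m ∧ q ≤ m ∧
      (2 : ℝ) ^ (2 * p) + 2 ^ (2 * q) = 2 ^ (2 * r2 i) + 2 ^ (2 * r2 j) ∧
      p ≤ r2 i ∧ r2 i + r2 j ≤ p + q := by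
    rcases le_total (r2 i) (r2 j) with h | h
    · exact ⟨r2 i, r2 j, a2, b2, by linarith, by linarith, rfl, le_rfl, le_rfl⟩
    · obtain ⟨n, hn, hn1, -⟩ := bc_mean (r2 i) (r2 j)
      have hT := bc_mono.2 h
      have c1 := (bc_mono (x := r2 i) (y := r1 i + r2 i)).2 (by linarith)
      have c2 := (bc_mono (x := r2 j) (y := r1 j + r2 j)).2 (by linarith)
      have hnm : n ≤ m := bc_mono.1 (by linarith)
      have hni : n ≤ r2 i := bc_mono.1 (by linarith)
      exact ⟨n, n, by linarith, by linarith, hnm, hnm, by linarith, hni, by linarith⟩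
  set r2' : ℕ → ℝ := fun l => if l = i then p else if l = j then q else r2 l with hr2'
  set r1' : ℕ → ℝ := fun l => if l = i then m - p else if l = j then m - q else r1 l with hr1'
  have x1 : r1' i = m - p := by simp [hr1']
  have x2 : r2' i = p := by simp [hr2']
  have y1 : r1' j = m - q := by simp [hr1', hlt.ne']
  have y2 : r2' j = q := by simp [hr2', hlt.ne']
  have z1 : ∀ l, l ≠ i → l ≠ j → r1' l = r1 l := fun l h h' => by simp [hr1', h, h']
  have z2 : ∀ l, l ≠ i → l ≠ j → r2' l = r2 l := fun l h h' => by simp [hr2', h, h']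
  clear_value r1' r2'
  have hmi' := bc_mono.2 hmi
  have hpi' := bc_mono.2 hpi
  have hfe : BCFeasible N σ2 E Eb1 Eb2 r1' r2' := by
    refine ⟨?_, ?_, ?_, ?_, ?_⟩
    · intro l hl
      by_cases h : l = i
      · rw [h, x1]; linarith
      by_cases h' : l = j
      · rw [h', y1]; linarith
      rw [z1 l h h']; exact f1 l hl
    · intro l hl
      by_cases h : l = i
      · rw [h, x2]; linarith
      by_cases h' : l = j
      · rw [h', y2]; linarith
      rw [z2 l h h']; exact f2 l hl
    · intro k hk
      refine le_trans ?_ (f3 k hk)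
      apply bc_upd_le (fun l => Fmin σ2 (r1 l) (r2 l)) (fun l => Fmin σ2 (r1' l) (r2' l)) i j k hi hlt
      · intro l h h'; simp only [z1 l h h', z2 l h h']
      · simp only [Fmin, x1, x2, sub_add_cancel]
        nlinarith
      · simp only [Fmin, x1, x2, y1, y2, sub_add_cancel]
        apply le_of_eq
        linear_combination (σ2 - 1) * hpq + hm
    · intro k hk
      refine le_trans ?_ (f4 k hk)
      apply bc_upd_le (fun l => (2 : ℝ) ^ (2 * (r1 l + r2 l)) - 1)
        (fun l => (2 : ℝ) ^ (2 * (r1' l + r2' l)) - 1) i j k hi hlt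
      · intro l h h'; simp only [z1 l h h', z2 l h h']
      · simp only [x1, x2, sub_add_cancel]
        linarith
      · simp only [x1, x2, y1, y2, sub_add_cancel]
        linarith
    · intro k hk
      refine le_trans ?_ (f5 k hk)
      apply bc_upd_le (fun l => (2 : ℝ) ^ (2 * r2 l) - 1)
        (fun l => (2 : ℝ) ^ (2 * r2' l) - 1) i j k hi hlt
      · intro l h h'; simp only [z2 l h h']
      · simp only [x2]
        linarith
      · simp only [x2, y2]
        linarith
  have ho := hopt r1' r2' hfe
  rw [bc_upd_sum r1 r1' i j N hlt z1, bc_upd_sum r2 r2' i j N hlt z2] at ho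
  simp only [if_pos hiM, if_pos hjM, x1, x2, y1, y2] at ho
  have k1 : 0 < μ1 * (2 * m - (r1 i + r2 i + (r1 j + r2 j))) := mul_pos hμ1 (by linarith)
  have k2 : 0 ≤ (μ2 - μ1) * (p + q - (r2 i + r2 j)) := mul_nonneg (by linarith) (by linarith)
  nlinarith
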